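/- arXiv:0807.4808 — 2 statements merged into one kernel-verified Lean document; each statement's English description precedes it below -/
import Mathlib

section
/- Let φ₁(x) = 1728·x·(x^2-11x-1)^5 / (x^4+228x^3+494x^2-228x+1)^3. There exists ε > 0 such that for all real x with |x| < ε, F(11/60, -29/60; 1/5; φ₁(x)) = (1 + 435x - 6670x^2 - 3335x^4 - 87x^5) · (1 - 228x + 494x^2 + 228x^3 + x^4)^(-29/20). -/
open Real

/-- The Gauss hypergeometric series `F(a,b;c;z) = ∑ ((a)_n (b)_n / ((c)_n n!)) z^n`,
where `(q)_n` is the rising (Pochhammer) factorial. -/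
noncomputable def hypgeo (a b c z : ℝ) : ℝ :=
  ∑' n : ℕ, ((∏ i ∈ Finset.range n, (a + i)) * (∏ i ∈ Finset.range n, (b + i)) /
    ((∏ i ∈ Finset.range n, (c + i)) * (Nat.factorial n))) * z ^ n

open Filter Topology

/-- The differentiated series of a real power series, as a power series for the derivative. -/
theorem HasFPowerSeriesOnBall.exists_deriv_coeff {f : ℝ → ℝ}
    {p : FormalMultilinearSeries ℝ ℝ ℝ} {x : ℝ} {r : ENNReal}
    (h : HasFPowerSeriesOnBall f p x r) :
    ∃ q : FormalMultilinearSeries ℝ ℝ ℝ, HasFPowerSeriesOnBall (deriv f) q x r ∧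
      ∀ n, q.coeff n = (n + 1) * p.coeff (n + 1) := by
  refine ⟨_, (ContinuousLinearMap.apply ℝ ℝ (1 : ℝ)).comp_hasFPowerSeriesOnBall h.fderiv, ?_⟩
  intro n
  have := p.derivSeries_coeff_one n
  refine Eq.trans rfl (this.trans ?_)
  rw [nsmul_eq_mul]
  push_cast
  rfl

theorem HasFPowerSeriesOnBall.hasSum_coeff {f : ℝ → ℝ} {p : FormalMultilinearSeries ℝ ℝ ℝ}
    {r : ENNReal} (h : HasFPowerSeriesOnBall f p 0 r) {z : ℝ} (hz : z ∈ Metric.eball (0 : ℝ) r) :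
    HasSum (fun n => p.coeff n * z ^ n) (f z) := by
  have := h.hasSum hz
  simpa [mul_comm] using this

theorem HasSum.mul_pow_shift {u : ℕ → ℝ} {z s : ℝ} (h : HasSum (fun n => u (n + 1) * z ^ n) s)
    (h0 : u 0 = 0) : HasSum (fun n => u n * z ^ n) (z * s) := by
  rw [← hasSum_nat_add_iff' 1]
  have := h.mul_left z
  simp only [Finset.sum_range_one, h0, zero_mul, sub_zero]
  exact this.congr_fun (fun n => by ring)

/-- A power series whose coefficients satisfy the hypergeometric recurrence solves the
hypergeometric differential equation. -/
theorem HasFPowerSeriesOnBall.hypergeometric_ode {f : ℝ → ℝ}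
    {p : FormalMultilinearSeries ℝ ℝ ℝ} {r : ENNReal} {a b c : ℝ}
    (h : HasFPowerSeriesOnBall f p 0 r)
    (hp : ∀ n : ℕ, (n + c) * (n + 1) * p.coeff (n + 1) = (n + a) * (n + b) * p.coeff n)
    {z : ℝ} (hz : z ∈ Metric.eball (0 : ℝ) r) :
    z * (1 - z) * deriv (deriv f) z + (c - (a + b + 1) * z) * deriv f z - a * b * f z = 0 := by
  obtain ⟨q, hq, hqc⟩ := h.exists_deriv_coeff
  obtain ⟨t, ht, htc⟩ := hq.exists_deriv_coeff
  have s0 := h.hasSum_coeff hz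
  have s1 := hq.hasSum_coeff hz
  have s2 := ht.hasSum_coeff hz
  have s1' : HasSum (fun n : ℕ => (n * p.coeff n) * z ^ n) (z * deriv f z) := by
    refine HasSum.mul_pow_shift (u := fun n : ℕ => n * p.coeff n) ?_ (by simp)
    simpa [hqc] using s1
  have s2' : HasSum (fun n : ℕ => (n * (n + 1) * p.coeff (n + 1)) * z ^ n)
      (z * deriv (deriv f) z) := by
    refine HasSum.mul_pow_shift (u := fun n : ℕ => n * (n + 1) * p.coeff (n + 1)) ?_ (by simp)
    simpa [hqc, htc, mul_assoc] using s2
  have s2'' : HasSum (fun n : ℕ => ((n - 1) * n * p.coeff n) * z ^ n)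
      (z * (z * deriv (deriv f) z)) := by
    refine HasSum.mul_pow_shift (u := fun n : ℕ => (n - 1) * n * p.coeff n) ?_ (by simp)
    simpa using s2'
  have key := (((s2'.sub s2'').add (s1.mul_left c)).sub (s1'.mul_left (a + b + 1))).sub
    (s0.mul_left (a * b))
  have hzero : HasSum (fun _ : ℕ => (0 : ℝ)) 0 := hasSum_zero
  have := key.unique (hzero.congr_fun (fun n => by
    rw [hqc]
    linear_combination z ^ n * hp n))
  linear_combination this

/-- An analytic solution, vanishing at a regular singular point `0`, of a second order linear
equation `x α y'' + β y' + γ y = 0` vanishes identically near `0` if no positive integer is an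
exponent. -/
theorem AnalyticAt.eventually_eq_zero_of_ode {y α β γ : ℝ → ℝ} (hy : AnalyticAt ℝ y 0)
    (hα : ContinuousAt α 0) (hβ : ContinuousAt β 0) (hγ : ContinuousAt γ 0) (hy0 : y 0 = 0)
    (hne : ∀ m : ℕ, m * α 0 + β 0 ≠ 0)
    (hode : ∀ᶠ x in 𝓝 0, x * α x * deriv (deriv y) x + β x * deriv y x + γ x * y x = 0) :
    ∀ᶠ x in 𝓝 0, y x = 0 := by
  by_contra hnz
  obtain ⟨n, g, hg, hg0, hyg'⟩ := hy.exists_eventuallyEq_pow_smul_nonzero_iff.mpr hnz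
  have hyg : y =ᶠ[𝓝 0] fun z => z ^ n * g z := hyg'.mono fun z hz => by simpa using hz
  clear hyg'
  obtain _ | m := n
  · have := hyg.eq_of_nhds
    simp [hy0] at this
    exact hg0 this.symm
  let k : ℝ → ℝ := fun x => (m + 1) * g x + x * deriv g x
  have hk : AnalyticAt ℝ k 0 := by
    have := hg.deriv
    fun_prop
  have hd1 : deriv y =ᶠ[𝓝 0] fun x => x ^ m * k x := by
    filter_upwards [hyg.eventuallyEq_nhds, hg.eventually_analyticAt] with x hx hgx
    rw [hx.deriv_eq]
    have := ((hasDerivAt_pow (m + 1) x).mul hgx.differentiableAt.hasDerivAt).deriv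
    refine Eq.trans this ?_
    simp only [k]
    push_cast
    ring
  have hd2 : ∀ᶠ x in 𝓝 (0 : ℝ), x * deriv (deriv y) x = x ^ m * (m * k x + x * deriv k x) := by
    filter_upwards [hd1.eventuallyEq_nhds, hk.eventually_analyticAt] with x hx hkx
    rw [hx.deriv_eq]
    have := ((hasDerivAt_pow m x).mul hkx.differentiableAt.hasDerivAt).deriv
    have h2 : deriv (fun x => x ^ m * k x) x = _ := this
    rw [h2]
    obtain _ | l := m
    · simp
    · simp only [Nat.add_sub_cancel]
      ring
  have hev : ∀ᶠ x in 𝓝[≠] (0 : ℝ),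
      α x * (m * k x + x * deriv k x) + β x * k x + γ x * (x * g x) = 0 := by
    filter_upwards [hode.filter_mono nhdsWithin_le_nhds, hd1.filter_mono nhdsWithin_le_nhds,
      hd2.filter_mono nhdsWithin_le_nhds, hyg.filter_mono nhdsWithin_le_nhds,
      self_mem_nhdsWithin] with x h0 h1 h2 h3 hx
    have hxm : x ^ m ≠ 0 := pow_ne_zero _ hx
    apply mul_left_cancel₀ hxm
    rw [h1, h3] at h0
    linear_combination h0 - α x * h2
  have hcont : ContinuousAt
      (fun x => α x * (m * k x + x * deriv k x) + β x * k x + γ x * (x * g x)) 0 := by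
    have h1 := hk.continuousAt
    have h2 := hk.deriv.continuousAt
    have h3 := hg.continuousAt
    fun_prop
  have hlim := tendsto_nhds_unique (hcont.tendsto.mono_left nhdsWithin_le_nhds)
    (tendsto_const_nhds.congr' (hev.mono fun x hx => hx.symm))
  have hk0 : k 0 = (m + 1) * g 0 := by simp [k]
  have : (m * α 0 + β 0) * ((m + 1) * g 0) = 0 := by
    rw [← hk0]
    linear_combination hlim
  exact (mul_ne_zero (hne m) (mul_ne_zero (by positivity) hg0)) this

theorem hypgeo_eq_ordinaryHypergeometric (a b c : ℝ) :
    hypgeo a b c = ordinaryHypergeometric a b c := by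
  have hprod (t : ℝ) (n : ℕ) :
      ∏ i ∈ Finset.range n, (t + i) = (ascPochhammer ℝ n).eval t := by
    induction n with
    | zero => simp
    | succ n ih => rw [Finset.prod_range_succ, ih, ascPochhammer_succ_eval]
  ext z
  rw [ordinaryHypergeometric_eq_tsum, hypgeo]
  refine tsum_congr fun n => ?_
  simp only [hprod, smul_eq_mul, div_eq_mul_inv, mul_inv]
  ring

theorem hypgeo_zero (a b c : ℝ) : hypgeo a b c 0 = 1 := by
  rw [hypgeo_eq_ordinaryHypergeometric, ordinaryHypergeometric_zero]

theorem hasFPowerSeriesOnBall_hypgeo {a b c : ℝ}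
    (habc : ∀ k : ℕ, (k : ℝ) ≠ -a ∧ (k : ℝ) ≠ -b ∧ (k : ℝ) ≠ -c) :
    HasFPowerSeriesOnBall (hypgeo a b c) (ordinaryHypergeometricSeries ℝ a b c) 0 1 := by
  have hr := ordinaryHypergeometricSeries_radius_eq_one ℝ a b c habc
  have := (ordinaryHypergeometricSeries ℝ a b c).hasFPowerSeriesOnBall (by simp [hr])
  rw [hr] at this
  rwa [hypgeo_eq_ordinaryHypergeometric]

theorem ordinaryHypergeometricSeries_coeff_succ {a b c : ℝ} (hc : ∀ k : ℕ, (k : ℝ) ≠ -c) (n : ℕ) :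
    (n + c) * (n + 1) * (ordinaryHypergeometricSeries ℝ a b c).coeff (n + 1) =
      (n + a) * (n + b) * (ordinaryHypergeometricSeries ℝ a b c).coeff n := by
  have h1 : (n : ℝ) + c ≠ 0 := fun h => hc n (by linarith)
  have h2 : (n : ℝ) + 1 ≠ 0 := by positivity
  simp only [ordinaryHypergeometricSeries, FormalMultilinearSeries.coeff_ofScalars,
    ordinaryHypergeometricCoefficient, ascPochhammer_succ_eval, Nat.factorial_succ]
  push_cast
  simp only [mul_inv, add_comm c]
  field_simp
  ring

theorem hypgeo_ode {a b c : ℝ}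
    (habc : ∀ k : ℕ, (k : ℝ) ≠ -a ∧ (k : ℝ) ≠ -b ∧ (k : ℝ) ≠ -c) {z : ℝ} (hz : |z| < 1) :
    z * (1 - z) * deriv (deriv (hypgeo a b c)) z + (c - (a + b + 1) * z) * deriv (hypgeo a b c) z
      - a * b * hypgeo a b c z = 0 :=
  (hasFPowerSeriesOnBall_hypgeo habc).hypergeometric_ode
    (ordinaryHypergeometricSeries_coeff_succ fun k => (habc k).2.2)
    (by simpa [enorm_eq_nnnorm, ← NNReal.coe_lt_coe] using hz)

theorem HasDerivAt.mul_rpow_const {q P : ℝ → ℝ} {q' P' x s : ℝ} (hq : HasDerivAt q q' x)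
    (hP : HasDerivAt P P' x) (hpos : 0 < P x) :
    HasDerivAt (fun x => q x * P x ^ s) ((q' * P x + s * q x * P') * P x ^ (s - 1)) x := by
  refine (hq.mul (hP.rpow_const (p := s) (Or.inl hpos.ne'))).congr_deriv ?_
  have : P x ^ s = P x ^ (s - 1) * P x := by
    rw [← Real.rpow_add_one hpos.ne', sub_add_cancel]
  rw [this]
  ring

namespace Icosahedral

/-- The icosahedral vertex form, without its factor `x`. -/
noncomputable def V (x : ℝ) : ℝ := x ^ 2 - 11 * x - 1

/-- The icosahedral face form. -/
noncomputable def P (x : ℝ) : ℝ := x ^ 4 + 228 * x ^ 3 + 494 * x ^ 2 - 228 * x + 1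

/-- The icosahedral edge form. -/
noncomputable def R (x : ℝ) : ℝ := x ^ 6 - 522 * x ^ 5 - 10005 * x ^ 4 - 10005 * x ^ 2 + 522 * x + 1

/-- The derivative of `V`. -/
noncomputable def dV (x : ℝ) : ℝ := 2 * x - 11

/-- The derivative of `P`. -/
noncomputable def dP (x : ℝ) : ℝ := 4 * x ^ 3 + 684 * x ^ 2 + 988 * x - 228

/-- The derivative of `R`. -/
noncomputable def dR (x : ℝ) : ℝ :=
  6 * x ^ 5 - 2610 * x ^ 4 - 40020 * x ^ 3 - 20010 * x + 522

/-- The polynomial factor of the algebraic evaluation. -/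
noncomputable def Q (x : ℝ) : ℝ := 1 + 435 * x - 6670 * x ^ 2 - 3335 * x ^ 4 - 87 * x ^ 5

/-- The derivative of `Q`. -/
noncomputable def dQ (x : ℝ) : ℝ := 435 - 13340 * x - 13340 * x ^ 3 - 435 * x ^ 4

/-- The second derivative of `Q`. -/
noncomputable def ddQ (x : ℝ) : ℝ := -13340 - 40020 * x ^ 2 - 1740 * x ^ 3

/-- The icosahedral covering. -/
noncomputable def φ (x : ℝ) : ℝ := 1728 * x * V x ^ 5 / P x ^ 3

/-- The derivative of the icosahedral covering. -/
noncomputable def dφ (x : ℝ) : ℝ := -1728 * V x ^ 4 * R x / P x ^ 4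

/-- The numerator of the logarithmic derivative of `dφ`. -/
noncomputable def W (x : ℝ) : ℝ := 4 * dV x * R x * P x + V x * dR x * P x - 4 * V x * R x * dP x

/-- The second derivative of the icosahedral covering. -/
noncomputable def ddφ (x : ℝ) : ℝ := -1728 * V x ^ 3 * W x / P x ^ 5

theorem hasDerivAt_poly {p : Polynomial ℝ} {f f' : ℝ → ℝ} (hf : ∀ x, p.eval x = f x)
    (hf' : ∀ x, p.derivative.eval x = f' x) (x : ℝ) : HasDerivAt f (f' x) x := by
  rw [← hf', ← funext hf]
  exact p.hasDerivAt x

open Polynomial in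
theorem hasDerivAt_V (x : ℝ) : HasDerivAt V (dV x) x :=
  hasDerivAt_poly (p := X ^ 2 - C 11 * X - C 1) (fun x => by simp [V])
    (fun x => by simp [dV]; norm_num) x

open Polynomial in
theorem hasDerivAt_P (x : ℝ) : HasDerivAt P (dP x) x :=
  hasDerivAt_poly (p := X ^ 4 + C 228 * X ^ 3 + C 494 * X ^ 2 - C 228 * X + C 1)
    (fun x => by simp [P]) (fun x => by simp [dP]; ring) x

open Polynomial in
theorem hasDerivAt_R (x : ℝ) : HasDerivAt R (dR x) x :=
  hasDerivAt_poly
    (p := X ^ 6 - C 522 * X ^ 5 - C 10005 * X ^ 4 - C 10005 * X ^ 2 + C 522 * X + C 1)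
    (fun x => by simp [R]) (fun x => by simp [dR]; ring) x

open Polynomial in
theorem hasDerivAt_Q (x : ℝ) : HasDerivAt Q (dQ x) x :=
  hasDerivAt_poly (p := C 1 + C 435 * X - C 6670 * X ^ 2 - C 3335 * X ^ 4 - C 87 * X ^ 5)
    (fun x => by simp [Q]) (fun x => by simp [dQ]; ring) x

open Polynomial in
theorem hasDerivAt_dQ (x : ℝ) : HasDerivAt dQ (ddQ x) x :=
  hasDerivAt_poly (p := C 435 - C 13340 * X - C 13340 * X ^ 3 - C 435 * X ^ 4)
    (fun x => by simp [dQ]) (fun x => by simp [ddQ]; ring) x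

open Polynomial in
theorem hasDerivAt_dP (x : ℝ) : HasDerivAt dP (12 * x ^ 2 + 1368 * x + 988) x :=
  hasDerivAt_poly (p := C 4 * X ^ 3 + C 684 * X ^ 2 + C 988 * X - C 228)
    (f' := fun x => 12 * x ^ 2 + 1368 * x + 988)
    (fun x => by simp [dP]) (fun x => by simp; ring) x

theorem hasDerivAt_φ {x : ℝ} (hP : P x ≠ 0) : HasDerivAt φ (dφ x) x := by
  have h := (((hasDerivAt_id x).const_mul 1728).mul ((hasDerivAt_V x).pow 5)).div
    ((hasDerivAt_P x).pow 3) (pow_ne_zero 3 hP)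
  refine h.congr_deriv ?_
  simp only [dφ, Pi.pow_apply, Pi.mul_apply, id]
  field_simp
  simp only [V, P, R, dV, dP]
  ring

theorem hasDerivAt_dφ {x : ℝ} (hP : P x ≠ 0) : HasDerivAt dφ (ddφ x) x := by
  have h := ((((hasDerivAt_V x).pow 4).const_mul (-1728)).mul (hasDerivAt_R x)).div
    ((hasDerivAt_P x).pow 4) (pow_ne_zero 4 hP)
  refine h.congr_deriv ?_
  simp only [ddφ, W, Pi.pow_apply, Pi.mul_apply]
  field_simp
  ring

/-- The syzygy between the icosahedral forms. -/
theorem P_cube_sub (x : ℝ) : P x ^ 3 - 1728 * x * V x ^ 5 = R x ^ 2 := by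
  simp only [P, V, R]
  ring

/-- The leading coefficient, without its factor `x`, of the pulled back equation. -/
noncomputable def α (x : ℝ) : ℝ := -(P x ^ 2 * V x * R x)

/-- The first order coefficient of the pulled back equation. -/
noncomputable def β (x : ℝ) : ℝ :=
  x * P x * W x + P x * (1 / 5 * P x ^ 3 - 7 / 10 * (1728 * x * V x ^ 5))

/-- The zeroth order coefficient of the pulled back equation. -/
noncomputable def γ (x : ℝ) : ℝ := -(11 / 60 * (-29 / 60)) * (-1728 * V x ^ 4 * R x)

theorem pullback_ode {x f₀ f₁ f₂ : ℝ} (hP : P x ≠ 0)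
    (h : φ x * (1 - φ x) * f₂ + (1 / 5 - (11 / 60 + -29 / 60 + 1) * φ x) * f₁
      - 11 / 60 * (-29 / 60) * f₀ = 0) :
    x * α x * (f₂ * dφ x * dφ x + f₁ * ddφ x) + β x * (f₁ * dφ x) + γ x * f₀ = 0 := by
  have h1 : 1 - φ x = R x ^ 2 / P x ^ 3 := by
    rw [← P_cube_sub, φ]
    field_simp
  have e2 : x * α x * dφ x ^ 2 = -1728 * V x ^ 4 * R x * (φ x * (1 - φ x)) := by
    rw [h1]
    simp only [α, dφ, φ]
    field_simp
  have e1 : x * α x * ddφ x + β x * dφ x =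
      -1728 * V x ^ 4 * R x * (1 / 5 - (11 / 60 + -29 / 60 + 1) * φ x) := by
    simp only [α, β, dφ, ddφ, φ]
    field_simp
    ring
  simp only [γ]
  linear_combination f₂ * e2 + f₁ * e1 + (-1728 * V x ^ 4 * R x) * h

/-- The algebraic solution. -/
noncomputable def G (x : ℝ) : ℝ := Q x * P x ^ (-29 / 20 : ℝ)

/-- The polynomial factor of the derivative of `G`. -/
noncomputable def Q₁ (x : ℝ) : ℝ := dQ x * P x + -29 / 20 * Q x * dP x

/-- The derivative of `Q₁`. -/
noncomputable def dQ₁ (x : ℝ) : ℝ :=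
  ddQ x * P x + dQ x * dP x + (-29 / 20 * dQ x * dP x
    + -29 / 20 * Q x * (12 * x ^ 2 + 1368 * x + 988))

/-- The polynomial factor of the second derivative of `G`. -/
noncomputable def Q₂ (x : ℝ) : ℝ := dQ₁ x * P x + (-29 / 20 - 1) * Q₁ x * dP x

theorem hasDerivAt_G {x : ℝ} (hP : 0 < P x) :
    HasDerivAt G (Q₁ x * P x ^ (-29 / 20 - 1 : ℝ)) x :=
  (hasDerivAt_Q x).mul_rpow_const (hasDerivAt_P x) hP

theorem hasDerivAt_Q₁ (x : ℝ) : HasDerivAt Q₁ (dQ₁ x) x := by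
  exact ((hasDerivAt_dQ x).mul (hasDerivAt_P x)).add
    (((hasDerivAt_Q x).const_mul (-29 / 20)).mul (hasDerivAt_dP x))

theorem hasDerivAt_deriv_G {x : ℝ} (hP : 0 < P x) :
    HasDerivAt (fun x => Q₁ x * P x ^ (-29 / 20 - 1 : ℝ))
      (Q₂ x * P x ^ (-29 / 20 - 1 - 1 : ℝ)) x :=
  (hasDerivAt_Q₁ x).mul_rpow_const (hasDerivAt_P x) hP

theorem G_poly_identity (x : ℝ) :
    x * α x * Q₂ x + β x * Q₁ x * P x + γ x * Q x * P x ^ 2 = 0 := by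
  simp only [α, β, γ, W, Q₂, dQ₁, Q₁, Q, dQ, ddQ, P, dP, V, dV, R, dR]
  ring

theorem G_ode {x : ℝ} (hP : 0 < P x) :
    x * α x * (Q₂ x * P x ^ (-29 / 20 - 1 - 1 : ℝ)) + β x * (Q₁ x * P x ^ (-29 / 20 - 1 : ℝ))
      + γ x * G x = 0 := by
  have h1 : P x ^ (-29 / 20 - 1 : ℝ) = P x ^ (-29 / 20 - 1 - 1 : ℝ) * P x := by
    rw [← Real.rpow_add_one hP.ne', sub_add_cancel]
  have h0 : P x ^ (-29 / 20 : ℝ) = P x ^ (-29 / 20 - 1 : ℝ) * P x := by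
    rw [← Real.rpow_add_one hP.ne', sub_add_cancel]
  rw [G, h0, h1]
  linear_combination (P x ^ (-29 / 20 - 1 - 1 : ℝ)) * G_poly_identity x

theorem analyticAt_P (x : ℝ) : AnalyticAt ℝ P x := by
  unfold P
  fun_prop

theorem analyticAt_φ {x : ℝ} (hP : P x ≠ 0) : AnalyticAt ℝ φ x := by
  have h := analyticAt_P x
  have hV : AnalyticAt ℝ V x := by
    unfold V
    fun_prop
  have : AnalyticAt ℝ (fun x => 1728 * x * V x ^ 5) x := by fun_prop
  exact this.div (h.pow 3) (pow_ne_zero 3 hP)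

theorem analyticAt_G {x : ℝ} (hP : 0 < P x) : AnalyticAt ℝ G x := by
  have hQ : AnalyticAt ℝ Q x := by
    unfold Q
    fun_prop
  have hE : AnalyticAt ℝ (fun t => Real.exp (Real.log (P t) * (-29 / 20))) x :=
    (((analyticAt_P x).log hP).mul analyticAt_const).rexp
  refine hQ.mul (hE.congr ?_)
  filter_upwards [(analyticAt_P x).continuousAt.eventually_const_lt hP] with t ht
  rw [Real.rpow_def_of_pos ht]

theorem hypgeo_comp_φ_eventually_eq :
    ∀ᶠ x in 𝓝 (0 : ℝ), hypgeo (11 / 60) (-29 / 60) (1 / 5) (φ x) = G x := by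
  set f := hypgeo (11 / 60) (-29 / 60) (1 / 5) with hf
  have habc : ∀ k : ℕ, (k : ℝ) ≠ -(11 / 60) ∧ (k : ℝ) ≠ -(-29 / 60) ∧ (k : ℝ) ≠ -(1 / 5) := by
    intro k
    have hk : (0 : ℝ) ≤ k := Nat.cast_nonneg k
    refine ⟨by linarith, fun h => ?_, by linarith⟩
    have : ((60 * k : ℕ) : ℝ) = (29 : ℕ) := by
      push_cast
      linarith
    have := Nat.cast_injective this
    omega
  have hP0 : P 0 = 1 := by simp [P]
  have hφ0 : φ 0 = 0 := by simp [φ]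
  have hφa : AnalyticAt ℝ φ 0 := analyticAt_φ (by simp [hP0])
  have hfa : AnalyticAt ℝ f 0 := (hasFPowerSeriesOnBall_hypgeo habc).analyticAt
  have hPpos : ∀ᶠ x in 𝓝 (0 : ℝ), 0 < P x :=
    (analyticAt_P 0).continuousAt.eventually_const_lt (by simp [hP0])
  have hφt : Tendsto φ (𝓝 0) (𝓝 0) := by simpa [hφ0] using hφa.continuousAt.tendsto
  have hfφ : ∀ᶠ x in 𝓝 (0 : ℝ), AnalyticAt ℝ f (φ x) := hφt.eventually hfa.eventually_analyticAt
  have hφ1 : ∀ᶠ x in 𝓝 (0 : ℝ), |φ x| < 1 := by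
    have : Tendsto (fun x => |φ x|) (𝓝 0) (𝓝 0) := by simpa using hφt.abs
    exact this.eventually_lt_const one_pos
  have hD : AnalyticAt ℝ (fun x => f (φ x) - G x) 0 := by
    have h1 : AnalyticAt ℝ (fun x => f (φ x)) 0 :=
      AnalyticAt.fun_comp (by rwa [hφ0]) hφa
    exact h1.sub (analyticAt_G (by simp [hP0]))
  have hd1 : deriv (fun x => f (φ x) - G x) =ᶠ[𝓝 0]
      fun x => deriv f (φ x) * dφ x - Q₁ x * P x ^ (-29 / 20 - 1 : ℝ) := by
    filter_upwards [hPpos, hfφ] with x hx hfx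
    exact ((hfx.differentiableAt.hasDerivAt.comp x (hasDerivAt_φ hx.ne')).sub
      (hasDerivAt_G hx)).deriv
  have hd2 : ∀ᶠ x in 𝓝 (0 : ℝ), deriv (deriv (fun x => f (φ x) - G x)) x =
      deriv (deriv f) (φ x) * dφ x * dφ x + deriv f (φ x) * ddφ x
        - Q₂ x * P x ^ (-29 / 20 - 1 - 1 : ℝ) := by
    filter_upwards [hd1.eventuallyEq_nhds, hPpos, hfφ] with x hd hx hfx
    rw [hd.deriv_eq]
    exact (((hfx.deriv.differentiableAt.hasDerivAt.comp x (hasDerivAt_φ hx.ne')).mul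
      (hasDerivAt_dφ hx.ne')).sub (hasDerivAt_deriv_G hx)).deriv
  have hode : ∀ᶠ x in 𝓝 (0 : ℝ), x * α x * deriv (deriv (fun x => f (φ x) - G x)) x
      + β x * deriv (fun x => f (φ x) - G x) x + γ x * (f (φ x) - G x) = 0 := by
    filter_upwards [hd1, hd2, hPpos, hφ1] with x h1 h2 hx hφx
    rw [h1, h2]
    linear_combination pullback_ode hx.ne' (hypgeo_ode habc hφx) - G_ode hx
  have hα0 : α 0 = 1 := by simp [α, P, V, R]
  have hβ0 : β 0 = 1 / 5 := by simp [β, P]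
  have hz := hD.eventually_eq_zero_of_ode (α := α) (β := β) (γ := γ)
    (by unfold α P V R; fun_prop) (by unfold β W P V R dV dR dP; fun_prop)
    (by unfold γ V R; fun_prop)
    (by simp [hφ0, hf, hypgeo_zero, G, Q, hP0])
    (fun m => by rw [hα0, hβ0]; positivity) hode
  exact hz.mono fun x hx => sub_eq_zero.mp hx

end Icosahedral

theorem stmt15 : ∃ ε > 0, ∀ x : ℝ, |x| < ε →
    hypgeo (11/60) (-29/60) (1/5) (1728 * x * (x^2 - 11*x - 1)^5 / (x^4 + 228*x^3 + 494*x^2 - 228*x + 1)^3) =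
      (1 + 435*x - 6670*x^2 - 3335*x^4 - 87*x^5) *
        (1 - 228*x + 494*x^2 + 228*x^3 + x^4) ^ ((-29 : ℝ)/20) := by
  obtain ⟨ε, hε, h⟩ := Metric.eventually_nhds_iff.mp Icosahedral.hypgeo_comp_φ_eventually_eq
  refine ⟨ε, hε, fun x hx => ?_⟩
  have hP : 1 - 228*x + 494*x^2 + 228*x^3 + x^4 = Icosahedral.P x := by
    simp only [Icosahedral.P]
    ring
  rw [hP]
  exact h (by simpa using hx)
end

section
/- Let φ₂(x) = 64·x·(x^2-x-1)^5 / ((x^2-1)·(x^2+4x-1)^5). There exists ε > 0 such that for all real x with 0 ≤ x < ε, F(7/20, -1/20; 4/5; φ₂(x)) = (1+x)^(7/20) / ((1-x)^(1/20) · (1-4x-x^2)^(1/4)). -/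
open Real

/-- The Gauss hypergeometric coefficient `(a)_n (b)_n / ((c)_n n!)`. -/
noncomputable def hypgeoCoeff (a b c : ℝ) (n : ℕ) : ℝ :=
  (∏ i ∈ Finset.range n, (a + i)) * (∏ i ∈ Finset.range n, (b + i)) /
    ((∏ i ∈ Finset.range n, (c + i)) * (Nat.factorial n))

lemma hypgeoCoeff_succ (a b c : ℝ) (n : ℕ) :
    hypgeoCoeff a b c (n + 1) =
      hypgeoCoeff a b c n * ((a + n) * (b + n) / ((c + n) * (n + 1))) := by
  unfold hypgeoCoeff
  rw [Finset.prod_range_succ, Finset.prod_range_succ, Finset.prod_range_succ, Nat.factorial_succ,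
    div_mul_div_comm]
  push_cast
  congr 1 <;> ring

/-- Coefficients of the derivative of a power series. -/
def derivCoeff (f : ℕ → ℝ) (n : ℕ) : ℝ := (n + 1) * f (n + 1)

/-- Sum of a real power series with given coefficients. -/
noncomputable def powerSum (f : ℕ → ℝ) (z : ℝ) : ℝ := ∑' n, f n * z ^ n

lemma summable_add_one_pow_mul_geometric (k : ℕ) {r : ℝ} (h0 : 0 < r) (h1 : r < 1) :
    Summable fun n : ℕ => ((n : ℝ) + 1) ^ k * r ^ n := by
  have h := (summable_nat_add_iff 1).2
    (summable_pow_mul_geometric_of_norm_lt_one k (r := r) (by rwa [norm_of_nonneg h0.le]))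
  refine (h.mul_left r⁻¹).congr fun n => ?_
  push_cast
  field_simp
  ring

lemma summable_of_abs_coeff_le {f : ℕ → ℝ} {C : ℝ} {k : ℕ}
    (hf : ∀ n : ℕ, |f n| ≤ C * ((n : ℝ) + 1) ^ k) {z : ℝ} (hz : |z| < 1) :
    Summable fun n => f n * z ^ n := by
  obtain ⟨r, hzr, hr1⟩ := exists_between hz
  have h0 : 0 < r := (abs_nonneg z).trans_lt hzr
  refine Summable.of_norm_bounded
    ((summable_add_one_pow_mul_geometric k h0 hr1).mul_left C) fun n => ?_
  rw [norm_mul, norm_pow, Real.norm_eq_abs, Real.norm_eq_abs, ← mul_assoc]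
  have hC : 0 ≤ C * ((n : ℝ) + 1) ^ k := (abs_nonneg _).trans (hf n)
  gcongr
  exact hf n

lemma abs_derivCoeff_le {f : ℕ → ℝ} {C : ℝ} {k : ℕ} (hC : 0 ≤ C)
    (hf : ∀ n : ℕ, |f n| ≤ C * ((n : ℝ) + 1) ^ k) (n : ℕ) :
    |derivCoeff f n| ≤ (C * 2 ^ k) * ((n : ℝ) + 1) ^ (k + 1) := by
  have hn : (0 : ℝ) ≤ n := n.cast_nonneg
  have h := hf (n + 1)
  have h2 : ((n : ℝ) + 1 + 1) ^ k ≤ (2 * ((n : ℝ) + 1)) ^ k := by gcongr; linarith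
  rw [derivCoeff, abs_mul, abs_of_nonneg (by positivity)]
  push_cast at h
  calc ((n : ℝ) + 1) * |f (n + 1)| ≤ ((n : ℝ) + 1) * (C * (2 * ((n : ℝ) + 1)) ^ k) := by
        gcongr
        exact h.trans (by gcongr)
    _ = _ := by rw [mul_pow]; ring

lemma hasDerivAt_powerSum {f : ℕ → ℝ} {C : ℝ} {k : ℕ} (hC : 0 ≤ C)
    (hf : ∀ n : ℕ, |f n| ≤ C * ((n : ℝ) + 1) ^ k) {z : ℝ} (hz : |z| < 1) :
    HasDerivAt (powerSum f) (powerSum (derivCoeff f) z) z := by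
  obtain ⟨r, hzr, hr1⟩ := exists_between hz
  have h0 : 0 < r := (abs_nonneg z).trans_lt hzr
  have hu : Summable fun n : ℕ => C * ((n : ℝ) + 1) ^ k * (n * r ^ (n - 1)) := by
    rw [← summable_nat_add_iff 1]
    refine Summable.of_nonneg_of_le (fun n => by positivity) (fun n => ?_)
      ((summable_add_one_pow_mul_geometric (k + 1) h0 hr1).mul_left (C * 2 ^ k))
    have hn : (0 : ℝ) ≤ n := n.cast_nonneg
    have h2 : ((n : ℝ) + 1 + 1) ^ k ≤ (2 * ((n : ℝ) + 1)) ^ k := by gcongr; linarith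
    simp only [Nat.add_sub_cancel]
    push_cast
    calc C * ((n : ℝ) + 1 + 1) ^ k * (((n : ℝ) + 1) * r ^ n)
        ≤ C * (2 * ((n : ℝ) + 1)) ^ k * (((n : ℝ) + 1) * r ^ n) := by gcongr
      _ = _ := by rw [mul_pow]; ring
  have key := hasDerivAt_tsum_of_isPreconnected (g := fun n y => f n * y ^ n)
    (g' := fun n y => f n * (n * y ^ (n - 1))) (t := Metric.ball (0 : ℝ) r) (y₀ := z) (y := z)
    hu Metric.isOpen_ball (convex_ball _ _).isPreconnected
    (fun n y _ => (hasDerivAt_pow n y).const_mul (f n))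
    (fun n y hy => ?_) (by simpa using hzr) (summable_of_abs_coeff_le hf hz) (by simpa using hzr)
  · have hs : Summable fun n => f n * (n * z ^ (n - 1)) := by
      rw [← summable_nat_add_iff 1]
      refine (summable_of_abs_coeff_le (abs_derivCoeff_le hC hf) hz).congr fun n => ?_
      simp [derivCoeff]
      ring
    have he : ∑' n : ℕ, f n * (n * z ^ (n - 1)) = powerSum (derivCoeff f) z := by
      rw [hs.tsum_eq_zero_add, powerSum]
      simp only [Nat.cast_zero, zero_mul, mul_zero, zero_add]
      refine tsum_congr fun n => ?_
      simp [derivCoeff]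
      ring
    rw [he] at key
    exact key
  · have hy' : |y| < r := by simpa using hy
    rw [norm_mul, norm_mul, norm_pow, Real.norm_eq_abs, Real.norm_eq_abs, Real.norm_eq_abs,
      Nat.abs_cast]
    have hn := hf n
    gcongr

lemma HasSum.mul_self_shift {f : ℕ → ℝ} {z s : ℝ} (h0 : f 0 = 0)
    (h : HasSum (fun n => f (n + 1) * z ^ n) s) : HasSum (fun n => f n * z ^ n) (z * s) := by
  rw [← hasSum_nat_add_iff' 1]
  simp only [Finset.range_one, Finset.sum_singleton, h0, zero_mul, sub_zero]
  refine (h.mul_left z).congr_fun fun n => ?_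
  ring

/-- The Gauss hypergeometric differential equation. -/
lemma powerSum_hypgeoCoeff_ode {a b c C : ℝ} {k : ℕ} (hc : ∀ n : ℕ, c + n ≠ 0) (hC : 0 ≤ C)
    (hf : ∀ n : ℕ, |hypgeoCoeff a b c n| ≤ C * ((n : ℝ) + 1) ^ k) {z : ℝ} (hz : |z| < 1) :
    z * (1 - z) * powerSum (derivCoeff (derivCoeff (hypgeoCoeff a b c))) z +
      (c - (a + b + 1) * z) * powerSum (derivCoeff (hypgeoCoeff a b c)) z -
      a * b * powerSum (hypgeoCoeff a b c) z = 0 := by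
  set f := hypgeoCoeff a b c with hfdef
  have hf1 := abs_derivCoeff_le hC hf
  have hf2 := abs_derivCoeff_le (by positivity) hf1
  have s0 : HasSum (fun n => f n * z ^ n) (powerSum f z) := (summable_of_abs_coeff_le hf hz).hasSum
  have s1 : HasSum (fun n => derivCoeff f n * z ^ n) (powerSum (derivCoeff f) z) :=
    (summable_of_abs_coeff_le hf1 hz).hasSum
  have s2 : HasSum (fun n => derivCoeff (derivCoeff f) n * z ^ n)
      (powerSum (derivCoeff (derivCoeff f)) z) := (summable_of_abs_coeff_le hf2 hz).hasSum
  have t1 : HasSum (fun n : ℕ => (n * f n) * z ^ n) (z * powerSum (derivCoeff f) z) :=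
    HasSum.mul_self_shift (f := fun n : ℕ => n * f n) (by simp)
      (by simpa [derivCoeff] using s1)
  have t2 : HasSum (fun n : ℕ => (n * derivCoeff f n) * z ^ n)
      (z * powerSum (derivCoeff (derivCoeff f)) z) :=
    HasSum.mul_self_shift (f := fun n : ℕ => n * derivCoeff f n) (by simp)
      (by simpa [derivCoeff] using s2)
  have t3 : HasSum (fun n : ℕ => ((n - 1) * (n * f n)) * z ^ n)
      (z * (z * powerSum (derivCoeff (derivCoeff f)) z)) :=
    HasSum.mul_self_shift (f := fun n : ℕ => ((n : ℝ) - 1) * (n * f n)) (by simp)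
      (by simpa [derivCoeff] using t2)
  have total := ((((t2.sub t3).add (s1.mul_left c)).sub (t1.mul_left (a + b + 1))).sub
    (s0.mul_left (a * b)))
  have hzero : HasSum (fun _ : ℕ => (0 : ℝ)) _ := total.congr_fun fun n => by
    have h1 : (c + n) * ((n : ℝ) + 1) * f (n + 1) = (a + n) * (b + n) * f n := by
      have hn : ((n : ℝ) + 1) ≠ 0 := by positivity
      have hcn := hc n
      rw [hfdef, hypgeoCoeff_succ]
      field_simp
    simp only [derivCoeff]
    linear_combination (-z ^ n) * h1
  have := hzero.unique hasSum_zero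
  linear_combination this

lemma abs_hypgeoCoeff_le_one (n : ℕ) : |hypgeoCoeff (7/20) (-1/20) (4/5) n| ≤ 1 := by
  induction n with
  | zero => simp [hypgeoCoeff]
  | succ n ih =>
    rw [hypgeoCoeff_succ, abs_mul]
    refine mul_le_one₀ ih (abs_nonneg _) ?_
    have hn : (0 : ℝ) ≤ n := n.cast_nonneg
    rw [abs_div, abs_of_pos (show 0 < (4/5 + (n : ℝ)) * (n + 1) by positivity),
      div_le_one (by positivity), abs_le]
    constructor <;> nlinarith

/-- A solution of `h' = -v h` on `(0, b)` with `x v ≥ 1/2` that is continuous at `0` vanishes. -/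
lemma eq_zero_of_hasDerivAt_singular {h v : ℝ → ℝ} {b : ℝ} (hb : 0 ≤ b)
    (hcont : ContinuousOn h (Set.Icc 0 b))
    (hd : ∀ x ∈ Set.Ioo 0 b, HasDerivAt h (-v x * h x) x)
    (hv : ∀ x ∈ Set.Ioo 0 b, 1 / 2 ≤ x * v x) : b * h b ^ 2 = 0 := by
  have hd' : ∀ x ∈ Set.Ioo 0 b,
      HasDerivAt (fun x => x * h x ^ 2) ((1 - 2 * (x * v x)) * h x ^ 2) x := fun x hx => by
    refine ((hasDerivAt_id' x).mul ((hd x hx).pow 2)).congr_deriv ?_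
    simp
    ring
  have hanti : AntitoneOn (fun x => x * h x ^ 2) (Set.Icc 0 b) := by
    refine antitoneOn_of_deriv_nonpos (convex_Icc _ _) (continuousOn_id.mul (hcont.pow 2)) ?_ ?_
    · rw [interior_Icc]
      exact fun x hx => (hd' x hx).differentiableAt.differentiableWithinAt
    · rw [interior_Icc]
      intro x hx
      rw [(hd' x hx).deriv]
      have := hv x hx
      exact mul_nonpos_of_nonpos_of_nonneg (by linarith) (sq_nonneg _)
  have h1 := hanti (Set.left_mem_Icc.2 hb) (Set.right_mem_Icc.2 hb) hb
  simp only [zero_mul] at h1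
  exact le_antisymm h1 (by positivity)

/-- The degree-twelve icosahedral covering map. -/
noncomputable def icosaMap (x : ℝ) : ℝ :=
  64 * x * (x^2 - x - 1)^5 / ((x^2 - 1) * (x^2 + 4*x - 1)^5)

/-- The derivative of `icosaMap`. -/
noncomputable def icosaMapDeriv (x : ℝ) : ℝ :=
  -64 * (x^2 - x - 1)^4 * (x^6 - 22*x^5 - 5*x^4 - 5*x^2 + 22*x + 1) /
    ((x^2 - 1)^2 * (x^2 + 4*x - 1)^6)

/-- The logarithmic derivative of the algebraic right-hand side. -/
noncomputable def algLogDeriv (x : ℝ) : ℝ :=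
  7/20 / (1 + x) + 1/20 / (1 - x) + (1/4) * (4 + 2*x) / (1 - 4*x - x^2)

lemma hasDerivAt_icosaMap {x : ℝ} (hB : x^2 - 1 ≠ 0) (hC : x^2 + 4*x - 1 ≠ 0) :
    HasDerivAt icosaMap (icosaMapDeriv x) x := by
  have h1 : HasDerivAt (fun x : ℝ => x^2 - x - 1) (2 * x - 1) x := by
    simpa using ((hasDerivAt_pow 2 x).sub (hasDerivAt_id' x)).sub_const 1
  have h2 : HasDerivAt (fun x : ℝ => x^2 - 1) (2 * x) x := by
    simpa using (hasDerivAt_pow 2 x).sub_const 1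
  have h3 : HasDerivAt (fun x : ℝ => x^2 + 4*x - 1) (2 * x + 4) x := by
    simpa using ((hasDerivAt_pow 2 x).add ((hasDerivAt_id' x).const_mul 4)).sub_const 1
  refine ((((hasDerivAt_id' x).const_mul 64).mul (h1.pow 5)).div (h2.mul (h3.pow 5))
    (mul_ne_zero hB (pow_ne_zero 5 hC))).congr_deriv ?_
  simp only [icosaMapDeriv, Pi.mul_apply, Pi.pow_apply]
  push_cast
  field_simp
  ring

lemma hasDerivAt_icosaMapDeriv {x : ℝ} (hA : x^2 - x - 1 ≠ 0) (hB : x^2 - 1 ≠ 0)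
    (hC : x^2 + 4*x - 1 ≠ 0) (hN : x^6 - 22*x^5 - 5*x^4 - 5*x^2 + 22*x + 1 ≠ 0) :
    HasDerivAt icosaMapDeriv (icosaMapDeriv x *
      (4 * (2*x - 1) / (x^2 - x - 1)
        + (6*x^5 - 110*x^4 - 20*x^3 - 10*x + 22) / (x^6 - 22*x^5 - 5*x^4 - 5*x^2 + 22*x + 1)
        - 4 * x / (x^2 - 1) - 6 * (2*x + 4) / (x^2 + 4*x - 1))) x := by
  have h1 : HasDerivAt (fun x : ℝ => x^2 - x - 1) (2 * x - 1) x := by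
    simpa using ((hasDerivAt_pow 2 x).sub (hasDerivAt_id' x)).sub_const 1
  have h2 : HasDerivAt (fun x : ℝ => x^2 - 1) (2 * x) x := by
    simpa using (hasDerivAt_pow 2 x).sub_const 1
  have h3 : HasDerivAt (fun x : ℝ => x^2 + 4*x - 1) (2 * x + 4) x := by
    simpa using ((hasDerivAt_pow 2 x).add ((hasDerivAt_id' x).const_mul 4)).sub_const 1
  have h4 : HasDerivAt (fun x : ℝ => x^6 - 22*x^5 - 5*x^4 - 5*x^2 + 22*x + 1)
      (6*x^5 - 110*x^4 - 20*x^3 - 10*x + 22) x := by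
    refine ((((((hasDerivAt_pow 6 x).sub ((hasDerivAt_pow 5 x).const_mul 22)).sub
      ((hasDerivAt_pow 4 x).const_mul 5)).sub ((hasDerivAt_pow 2 x).const_mul 5)).add
      ((hasDerivAt_id' x).const_mul 22)).add_const 1).congr_deriv ?_
    norm_num
    ring
  refine ((((h1.pow 4).const_mul (-64)).mul h4).div ((h2.pow 2).mul (h3.pow 6))
    (mul_ne_zero (pow_ne_zero 2 hB) (pow_ne_zero 6 hC))).congr_deriv ?_
  simp only [icosaMapDeriv, Pi.mul_apply, Pi.pow_apply]
  push_cast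
  generalize x^2 - x - 1 = A at *
  generalize x^2 - 1 = B at *
  generalize x^2 + 4*x - 1 = C at *
  generalize x^6 - 22*x^5 - 5*x^4 - 5*x^2 + 22*x + 1 = N at *
  field_simp
  ring

lemma hasDerivAt_algLogDeriv {x : ℝ} (h1 : 1 + x ≠ 0) (h2 : 1 - x ≠ 0)
    (h3 : 1 - 4*x - x^2 ≠ 0) :
    HasDerivAt algLogDeriv (-(7/20) / (1 + x)^2 + 1/20 / (1 - x)^2 +
      (1/4) * (2 * (1 - 4*x - x^2) + (4 + 2*x)^2) / (1 - 4*x - x^2)^2) x := by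
  have d1 : HasDerivAt (fun x : ℝ => 1 + x) 1 x := (hasDerivAt_id' x).const_add 1
  have d2 : HasDerivAt (fun x : ℝ => 1 - x) (-1) x := (hasDerivAt_id' x).const_sub 1
  have d3 : HasDerivAt (fun x : ℝ => 1 - 4*x - x^2) (-4 - 2*x) x := by
    exact ((((hasDerivAt_id' x).const_mul 4).const_sub 1).sub (hasDerivAt_pow 2 x)).congr_deriv
      (by norm_num)
  have d4 : HasDerivAt (fun x : ℝ => (1/4) * (4 + 2*x)) (1/2) x :=
    ((((hasDerivAt_id' x).const_mul 2).const_add 4).const_mul (1/4)).congr_deriv (by norm_num)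
  refine ((((hasDerivAt_const x (7/20 : ℝ)).div d1 h1).add
    ((hasDerivAt_const x (1/20 : ℝ)).div d2 h2)).add (d4.div d3 h3)).congr_deriv ?_
  congr 1
  · congr 1 <;> ring
  · congr 1
    ring

/-- The coefficient `v` of the factorisation `(D + v) (D - algLogDeriv)` of the pulled-back
hypergeometric operator. -/
noncomputable def cofactorCoeff (x : ℝ) : ℝ :=
  4/5 / x - 13/20 / (1 - x) + 21/20 / (1 + x) + (3/4) * (4 + 2*x) / (1 - 4*x - x^2)

lemma one_sub_icosaMap {x : ℝ} (hB : x^2 - 1 ≠ 0) (hC : x^2 + 4*x - 1 ≠ 0) :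
    1 - icosaMap x = (x^6 - 22*x^5 - 5*x^4 - 5*x^2 + 22*x + 1)^2 /
      ((x^2 - 1) * (x^2 + 4*x - 1)^5) := by
  rw [icosaMap, eq_div_iff (mul_ne_zero hB (pow_ne_zero 5 hC)), sub_mul,
    div_mul_cancel₀ _ (mul_ne_zero hB (pow_ne_zero 5 hC))]
  ring

lemma icosaMap_ode_aux {x F₀ F₁ F₂ : ℝ} (hx : x ≠ 0) (hA : x^2 - x - 1 ≠ 0) (h1 : 1 + x ≠ 0)
    (h2 : 1 - x ≠ 0) (h3 : 1 - 4*x - x^2 ≠ 0)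
    (hN : x^6 - 22*x^5 - 5*x^4 - 5*x^2 + 22*x + 1 ≠ 0)
    (ode : icosaMap x * (1 - icosaMap x) * F₂ +
      (4/5 - (7/20 + -1/20 + 1) * icosaMap x) * F₁ - 7/20 * (-1/20) * F₀ = 0) :
    F₂ * icosaMapDeriv x * icosaMapDeriv x + F₁ * (icosaMapDeriv x *
      (4 * (2*x - 1) / (x^2 - x - 1)
        + (6*x^5 - 110*x^4 - 20*x^3 - 10*x + 22) / (x^6 - 22*x^5 - 5*x^4 - 5*x^2 + 22*x + 1)
        - 4 * x / (x^2 - 1) - 6 * (2*x + 4) / (x^2 + 4*x - 1))) -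
      ((-(7/20) / (1 + x)^2 + 1/20 / (1 - x)^2 +
        (1/4) * (2 * (1 - 4*x - x^2) + (4 + 2*x)^2) / (1 - 4*x - x^2)^2) * F₀ +
        algLogDeriv x * (F₁ * icosaMapDeriv x)) =
      -cofactorCoeff x * (F₁ * icosaMapDeriv x - algLogDeriv x * F₀) := by
  have eB : x^2 - 1 = -((1 - x) * (1 + x)) := by ring
  have eC : x^2 + 4*x - 1 = -(1 - 4*x - x^2) := by ring
  have hB : x^2 - 1 ≠ 0 := by rw [eB]; exact neg_ne_zero.2 (mul_ne_zero h2 h1)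
  have hC : x^2 + 4*x - 1 ≠ 0 := by rw [eC]; exact neg_ne_zero.2 h3
  have hlog : (4 * (2*x - 1) / (x^2 - x - 1)
        + (6*x^5 - 110*x^4 - 20*x^3 - 10*x + 22) / (x^6 - 22*x^5 - 5*x^4 - 5*x^2 + 22*x + 1)
        - 4 * x / (x^2 - 1) - 6 * (2*x + 4) / (x^2 + 4*x - 1))
      + 4/5 * ((x^6 - 22*x^5 - 5*x^4 - 5*x^2 + 22*x + 1) /
        (x * (x^2 - x - 1) * (x^2 - 1) * (x^2 + 4*x - 1)))
      - 32 * (x^2 - x - 1)^4 /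
        ((x^2 - 1) * (x^2 + 4*x - 1) * (x^6 - 22*x^5 - 5*x^4 - 5*x^2 + 22*x + 1))
      - algLogDeriv x = -cofactorCoeff x := by
    rw [eB, eC, algLogDeriv, cofactorCoeff]
    generalize hA' : x^2 - x - 1 = A at hA ⊢
    generalize hC' : 1 - 4*x - x^2 = C at h3 ⊢
    generalize hN' : x^6 - 22*x^5 - 5*x^4 - 5*x^2 + 22*x + 1 = N at hN ⊢
    field_simp
    subst hA' hC' hN'
    ring
  have hconst : 7/20 * (-1/20) * (64 * (x^2 - x - 1)^3 / (x * (x^2 - 1)^2 * (x^2 + 4*x - 1)^2))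
      - (-(7/20) / (1 + x)^2 + 1/20 / (1 - x)^2 +
        (1/4) * (2 * (1 - 4*x - x^2) + (4 + 2*x)^2) / (1 - 4*x - x^2)^2)
      = cofactorCoeff x * algLogDeriv x := by
    rw [eB, eC, algLogDeriv, cofactorCoeff]
    generalize hC' : 1 - 4*x - x^2 = C at h3 ⊢
    field_simp
    subst hC'
    ring
  have hq := one_sub_icosaMap hB hC
  have hsq : icosaMapDeriv x * icosaMapDeriv x =
      64 * (x^2 - x - 1)^3 / (x * (x^2 - 1)^2 * (x^2 + 4*x - 1)^2) *
        (icosaMap x * (1 - icosaMap x)) := by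
    rw [hq, icosaMapDeriv, icosaMap]
    generalize x^2 - x - 1 = A at *
    generalize x^2 - 1 = B at *
    generalize x^2 + 4*x - 1 = C at *
    generalize x^6 - 22*x^5 - 5*x^4 - 5*x^2 + 22*x + 1 = N at *
    field_simp
  have hzero : 64 * (x^2 - x - 1)^3 / (x * (x^2 - 1)^2 * (x^2 + 4*x - 1)^2) *
      (1 - icosaMap x) = -((x^6 - 22*x^5 - 5*x^4 - 5*x^2 + 22*x + 1) /
        (x * (x^2 - x - 1) * (x^2 - 1) * (x^2 + 4*x - 1))) * icosaMapDeriv x := by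
    rw [hq, icosaMapDeriv]
    generalize x^2 - x - 1 = A at *
    generalize x^2 - 1 = B at *
    generalize x^2 + 4*x - 1 = C at *
    generalize x^6 - 22*x^5 - 5*x^4 - 5*x^2 + 22*x + 1 = N at *
    field_simp
  have hone : 64 * (x^2 - x - 1)^3 / (x * (x^2 - 1)^2 * (x^2 + 4*x - 1)^2) * icosaMap x =
      -(64 * (x^2 - x - 1)^4 /
        ((x^2 - 1) * (x^2 + 4*x - 1) * (x^6 - 22*x^5 - 5*x^4 - 5*x^2 + 22*x + 1))) *
        icosaMapDeriv x := by
    rw [icosaMapDeriv, icosaMap]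
    generalize x^2 - x - 1 = A at *
    generalize x^2 - 1 = B at *
    generalize x^2 + 4*x - 1 = C at *
    generalize x^6 - 22*x^5 - 5*x^4 - 5*x^2 + 22*x + 1 = N at *
    field_simp
  linear_combination F₂ * hsq
    + 64 * (x^2 - x - 1)^3 / (x * (x^2 - 1)^2 * (x^2 + 4*x - 1)^2) * ode
    - 4/5 * F₁ * hzero + 1/2 * F₁ * hone + F₁ * icosaMapDeriv x * hlog + F₀ * hconst

lemma hasDerivAt_inv_alg {x : ℝ} (h1 : 0 < 1 + x) (h2 : 0 < 1 - x) (h3 : 0 < 1 - 4*x - x^2) :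
    HasDerivAt (fun x : ℝ => (1 - x) ^ ((1 : ℝ)/20) * (1 - 4*x - x^2) ^ ((1 : ℝ)/4) /
        (1 + x) ^ ((7 : ℝ)/20))
      (-algLogDeriv x * ((1 - x) ^ ((1 : ℝ)/20) * (1 - 4*x - x^2) ^ ((1 : ℝ)/4) /
        (1 + x) ^ ((7 : ℝ)/20))) x := by
  have d1 : HasDerivAt (fun x : ℝ => 1 + x) 1 x := (hasDerivAt_id' x).const_add 1
  have d2 : HasDerivAt (fun x : ℝ => 1 - x) (-1) x := (hasDerivAt_id' x).const_sub 1
  have d3 : HasDerivAt (fun x : ℝ => 1 - 4*x - x^2) (-4 - 2*x) x :=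
    ((((hasDerivAt_id' x).const_mul 4).const_sub 1).sub (hasDerivAt_pow 2 x)).congr_deriv
      (by norm_num)
  have p1 := (rpow_pos_of_pos h1 (7/20)).ne'
  refine (((d2.rpow_const (p := 1/20) (.inl h2.ne')).mul
    (d3.rpow_const (p := 1/4) (.inl h3.ne'))).div
    (d1.rpow_const (p := 7/20) (.inl h1.ne')) p1).congr_deriv ?_
  simp only [Pi.mul_apply, rpow_sub_one h1.ne', rpow_sub_one h2.ne', rpow_sub_one h3.ne',
    algLogDeriv]
  field_simp
  ring

theorem stmt16 : ∃ ε > 0, ∀ x : ℝ, 0 ≤ x → x < ε →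
    hypgeo (7/20) (-1/20) (4/5)
        (64 * x * (x^2 - x - 1)^5 / ((x^2 - 1) * (x^2 + 4*x - 1)^5)) =
      (1 + x) ^ ((7 : ℝ)/20) /
        ((1 - x) ^ ((1 : ℝ)/20) * (1 - 4*x - x^2) ^ ((1 : ℝ)/4)) := by
  obtain ⟨δ, hδ, hφ⟩ : ∃ δ > 0, ∀ x : ℝ, |x| < δ → |icosaMap x| < 1 := by
    have hc : ContinuousAt icosaMap 0 :=
      (hasDerivAt_icosaMap (x := 0) (by norm_num) (by norm_num)).continuousAt
    obtain ⟨δ, hδ, h⟩ := Metric.continuousAt_iff.1 hc 1 one_pos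
    refine ⟨δ, hδ, fun x hx => ?_⟩
    have h0 : icosaMap 0 = 0 := by simp [icosaMap]
    simpa [h0, Real.dist_eq] using h (x := x) (by simpa [Real.dist_eq] using hx)
  refine ⟨min δ (1/100), by positivity, fun b hb0 hb => ?_⟩
  set f := hypgeoCoeff (7/20) (-1/20) (4/5) with hf
  have hf0 : ∀ n : ℕ, |f n| ≤ 1 * ((n : ℝ) + 1) ^ 0 := fun n => by
    simpa using abs_hypgeoCoeff_le_one n
  have hf1 := abs_derivCoeff_le zero_le_one hf0
  have hsmall : ∀ x ∈ Set.Icc 0 b, |icosaMap x| < 1 ∧ 0 ≤ x ∧ x < 1/100 := fun x hx => by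
    have h := hx.2.trans_lt hb
    exact ⟨hφ x (by rw [abs_of_nonneg hx.1]; exact h.trans_le (min_le_left _ _)), hx.1,
      h.trans_le (min_le_right _ _)⟩
  have hpos : ∀ x ∈ Set.Icc 0 b, x^2 - x - 1 ≠ 0 ∧ x^2 - 1 ≠ 0 ∧ x^2 + 4*x - 1 ≠ 0 ∧
      0 < 1 + x ∧ 0 < 1 - x ∧ 0 < 1 - 4*x - x^2 ∧
      x^6 - 22*x^5 - 5*x^4 - 5*x^2 + 22*x + 1 ≠ 0 := fun x hx => by
    obtain ⟨-, h0, h1⟩ := hsmall x hx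
    have hx2 : x^2 ≤ 1/100 * x := by nlinarith
    have hx4 : x^4 ≤ 1/100 * x := by
      have := pow_le_pow_of_le_one h0 (by linarith) (show 2 ≤ 4 by norm_num)
      linarith
    have hx5 : x^5 ≤ 1/100 * x := by
      have := pow_le_pow_of_le_one h0 (by linarith) (show 2 ≤ 5 by norm_num)
      linarith
    have hx6 : 0 ≤ x^6 := by positivity
    have hxx : 0 ≤ x^2 := by positivity
    refine ⟨?_, ?_, ?_, ?_, ?_, ?_, ?_⟩
    all_goals linarith
  set y : ℝ → ℝ := fun x => powerSum f (icosaMap x) with hy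
  set h : ℝ → ℝ := fun x =>
    powerSum (derivCoeff f) (icosaMap x) * icosaMapDeriv x - algLogDeriv x * y x with hh
  have dy : ∀ x ∈ Set.Icc 0 b,
      HasDerivAt y (powerSum (derivCoeff f) (icosaMap x) * icosaMapDeriv x) x := fun x hx => by
    obtain ⟨-, hB, hC, -⟩ := hpos x hx
    exact (hasDerivAt_powerSum zero_le_one hf0 (hsmall x hx).1).comp x (hasDerivAt_icosaMap hB hC)
  have dh : ∀ x ∈ Set.Icc 0 b, HasDerivAt h _ x := fun x hx => by
    obtain ⟨hA, hB, hC, h1, h2, h3, hN⟩ := hpos x hx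
    exact (((hasDerivAt_powerSum (by positivity) hf1 (hsmall x hx).1).comp x
      (hasDerivAt_icosaMap hB hC)).mul (hasDerivAt_icosaMapDeriv hA hB hC hN)).sub
      ((hasDerivAt_algLogDeriv h1.ne' h2.ne' h3.ne').mul (dy x hx))
  have hzero : ∀ x ∈ Set.Ioo 0 b, h x = 0 := fun x hx => by
    have hsub : Set.Icc 0 x ⊆ Set.Icc 0 b := Set.Icc_subset_Icc_right hx.2.le
    have := eq_zero_of_hasDerivAt_singular (h := h) (v := cofactorCoeff) hx.1.le
      (fun t ht => (dh t (hsub ht)).continuousAt.continuousWithinAt)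
      (fun t ht => ?_) (fun t ht => ?_)
    · simpa [hx.1.ne'] using this
    · have ht' := hsub (Set.Ioo_subset_Icc_self ht)
      obtain ⟨hA, hB, hC, h1, h2, h3, hN⟩ := hpos t ht'
      refine (dh t ht').congr_deriv ?_
      refine icosaMap_ode_aux ht.1.ne' hA h1.ne' h2.ne' h3.ne' hN ?_
      exact powerSum_hypgeoCoeff_ode (fun n => by positivity) zero_le_one hf0 (hsmall t ht').1
    · have ht' := hsub (Set.Ioo_subset_Icc_self ht)
      obtain ⟨-, -, -, h1, h2, h3, -⟩ := hpos t ht'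
      obtain ⟨-, h0, ht1⟩ := hsmall t ht'
      have e1 : t * (13/20 / (1 - t)) ≤ 3/10 := by
        rw [← mul_div_assoc, div_le_iff₀ h2]
        linarith
      have e2 : 0 ≤ t * (21/20 / (1 + t)) := by positivity
      have e3 : 0 ≤ t * ((3/4) * (4 + 2*t) / (1 - 4*t - t^2)) := by positivity
      have e0 : t * (4/5 / t) = 4/5 := mul_div_cancel₀ _ ht.1.ne'
      have : t * cofactorCoeff t = t * (4/5 / t) - t * (13/20 / (1 - t)) +
        t * (21/20 / (1 + t)) + t * ((3/4) * (4 + 2*t) / (1 - 4*t - t^2)) := by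
        rw [cofactorCoeff]; ring
      linarith
  set S : ℝ → ℝ := fun x => (1 - x) ^ ((1 : ℝ)/20) * (1 - 4*x - x^2) ^ ((1 : ℝ)/4) /
        (1 + x) ^ ((7 : ℝ)/20) with hS
  have hy0 : y 0 * S 0 = 1 := by
    have h1 : y 0 = 1 := by
      simp only [hy, powerSum]
      rw [tsum_eq_single 0 (fun n hn => by simp [icosaMap, hn])]
      simp [hf, hypgeoCoeff]
    simp [h1, hS]
  have dS : ∀ x ∈ Set.Icc 0 b, HasDerivAt S (-algLogDeriv x * S x) x := fun x hx => by
    obtain ⟨-, -, -, h1, h2, h3, -⟩ := hpos x hx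
    exact hasDerivAt_inv_alg h1 h2 h3
  have hend : y b * S b = 1 := by
    rcases hb0.eq_or_lt with rfl | hlt
    · exact hy0
    obtain ⟨t, ht, hslope⟩ := exists_hasDerivAt_eq_slope (fun x => y x * S x) _ hlt
      (fun x hx => ((dy x hx).mul (dS x hx)).continuousAt.continuousWithinAt)
      (fun x hx => (dy x (Set.Ioo_subset_Icc_self hx)).mul (dS x (Set.Ioo_subset_Icc_self hx)))
    have h1 : (y b * S b - y 0 * S 0) / (b - 0) = h t * S t := by
      rw [← hslope, hh]
      ring
    rw [hzero t ht, zero_mul, div_eq_zero_iff] at h1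
    rcases h1 with h1 | h1 <;> linarith
  obtain ⟨-, -, -, h1, h2, h3, -⟩ := hpos b (Set.right_mem_Icc.2 hb0)
  change y b = _
  have p1 := (rpow_pos_of_pos h1 (7/20)).ne'
  have p2 := (rpow_pos_of_pos h2 (1/20)).ne'
  have p3 := (rpow_pos_of_pos h3 (1/4)).ne'
  rw [eq_div_iff (mul_ne_zero p2 p3)]
  simp only [hS] at hend
  rw [← mul_div_assoc, div_eq_iff p1, one_mul] at hend
  exact hend
end
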